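/- arXiv:1806.04712 — 2 statements merged into one kernel-verified Lean document; each statement's English description precedes it below -/
import Mathlib

section
/- Let m₁ and m₂ be distinct positive integers, let j₁, j₂, j₃ ∈ {0,1}, and let ε ∈ {+1,−1}. With f₁ = cos and f₀ = sin, the function F : T³ → ℝ given by F(x₁,x₂,x₃) = f_{j₁}(m₁x₁)·f_{j₂}(m₂x₂) + ε·f_{1−j₁}(m₁x₁)·f_{j₃}(m₂x₃) has exactly two nodal domains. -/
noncomputable section

/-- `cos (m x)` is `2π`-periodic. -/
lemma cos_mul_periodic (m : ℕ) :
    Function.Periodic (fun x : ℝ => Real.cos (m * x)) (2 * Real.pi) := by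
  intro x
  have h : (m : ℝ) * (x + 2 * Real.pi) = m * x + (m : ℤ) * (2 * Real.pi) := by
    push_cast; ring
  simp only [h, Real.cos_add_int_mul_two_pi]

/-- `sin (m x)` is `2π`-periodic. -/
lemma sin_mul_periodic (m : ℕ) :
    Function.Periodic (fun x : ℝ => Real.sin (m * x)) (2 * Real.pi) := by
  intro x
  have h : (m : ℝ) * (x + 2 * Real.pi) = m * x + (m : ℤ) * (2 * Real.pi) := by
    push_cast; ring
  simp only [h, Real.sin_add_int_mul_two_pi]

/-- The function `cos (m ·)` on the circle `ℝ/2πℤ`. -/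
def cosT (m : ℕ) : AddCircle (2 * Real.pi) → ℝ := (cos_mul_periodic m).lift

/-- The function `sin (m ·)` on the circle `ℝ/2πℤ`. -/
def sinT (m : ℕ) : AddCircle (2 * Real.pi) → ℝ := (sin_mul_periodic m).lift

/-- `f₁ = cos`, `f₀ = sin` (with frequency `m`) on the circle `ℝ/2πℤ`. -/
def fT (j : Fin 2) (m : ℕ) : AddCircle (2 * Real.pi) → ℝ :=
  if j = 1 then cosT m else sinT m

/-- The flat 3-torus `T³ = (ℝ/2πℤ)³`. -/
abbrev T3 := AddCircle (2 * Real.pi) × AddCircle (2 * Real.pi) × AddCircle (2 * Real.pi)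

open Set

/-- The model function on `ℝ³`. -/
def gModel (p : ℝ × ℝ × ℝ) : ℝ :=
  Real.cos p.1 * Real.cos p.2.1 + Real.sin p.1 * Real.cos p.2.2

/-- The positivity set of the model function. -/
def sModel : Set (ℝ × ℝ × ℝ) := {p | 0 < gModel p}

lemma joined_seg (t u v t' u' v' : ℝ)
    (h : ∀ s : ℝ, 0 ≤ s → s ≤ 1 →
      0 < gModel (t + s * (t' - t), u + s * (u' - u), v + s * (v' - v))) :
    JoinedIn sModel (t, u, v) (t', u', v') := by
  refine JoinedIn.ofLine (f := fun s : ℝ =>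
    (t + s * (t' - t), u + s * (u' - u), v + s * (v' - v))) ?_ ?_ ?_ ?_
  · exact Continuous.continuousOn (by fun_prop)
  · simp
  · simp
  · rintro _ ⟨s, hs, rfl⟩
    exact h s hs.1 hs.2

lemma exists_peak (u : ℝ) : ∃ n : ℤ, ∀ s : ℝ, 0 ≤ s → s ≤ 1 →
    Real.cos u ≤ Real.cos (u + s * (n * (2 * Real.pi) - u)) := by
  refine ⟨round (u / (2 * Real.pi)), fun s hs0 hs1 => ?_⟩
  set n := round (u / (2 * Real.pi)) with hn
  have hpi := Real.pi_pos
  have hw : |u - n * (2 * Real.pi)| ≤ Real.pi := by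
    have h := abs_sub_round (u / (2 * Real.pi))
    rw [← hn] at h
    have e : u - n * (2 * Real.pi) = (u / (2 * Real.pi) - n) * (2 * Real.pi) := by
      field_simp
    rw [e, abs_mul, abs_of_pos (by positivity : (0:ℝ) < 2 * Real.pi)]
    nlinarith
  have e1 : Real.cos u = Real.cos |u - n * (2 * Real.pi)| := by
    rw [Real.cos_abs, Real.cos_sub_int_mul_two_pi]
  have e2 : Real.cos (u + s * (n * (2 * Real.pi) - u))
      = Real.cos ((1 - s) * |u - n * (2 * Real.pi)|) := by
    rw [← abs_of_nonneg (by linarith : 0 ≤ 1 - s), ← abs_mul, Real.cos_abs,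
      ← Real.cos_sub_int_mul_two_pi _ n]
    congr 1; ring
  rw [e1, e2]
  apply Real.cos_le_cos_of_nonneg_of_le_pi
  · exact mul_nonneg (by linarith) (abs_nonneg _)
  · exact hw
  · nlinarith [abs_nonneg (u - n * (2 * Real.pi))]

lemma cos_add_sin_pos {t : ℝ} (h0 : 0 ≤ t) (h1 : t ≤ Real.pi / 2) :
    0 < Real.cos t + Real.sin t := by
  have hc : 0 ≤ Real.cos t := Real.cos_nonneg_of_mem_Icc ⟨by linarith [Real.pi_pos], h1⟩
  have hs : 0 ≤ Real.sin t := Real.sin_nonneg_of_nonneg_of_le_pi h0 (by linarith [Real.pi_pos])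
  nlinarith [Real.sin_sq_add_cos_sq t]

lemma joined_quadrant {t : ℝ} (h0 : 0 ≤ t) (h1 : t ≤ Real.pi / 2) (u v : ℝ)
    (h : 0 < gModel (t, u, v)) : JoinedIn sModel (t, u, v) (0, 0, 0) := by
  have hpi := Real.pi_pos
  have hc : 0 ≤ Real.cos t := Real.cos_nonneg_of_mem_Icc ⟨by linarith, h1⟩
  have hs : 0 ≤ Real.sin t := Real.sin_nonneg_of_nonneg_of_le_pi h0 (by linarith)
  obtain ⟨a, ha⟩ := exists_peak u
  obtain ⟨b, hb⟩ := exists_peak v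
  have s1 : JoinedIn sModel (t, u, v) (t, a * (2 * Real.pi), b * (2 * Real.pi)) := by
    apply joined_seg
    intro s hs0 hs1
    simp only [gModel, sub_self, mul_zero, add_zero] at h ⊢
    nlinarith [mul_le_mul_of_nonneg_left (ha s hs0 hs1) hc,
      mul_le_mul_of_nonneg_left (hb s hs0 hs1) hs]
  have s2 : JoinedIn sModel (t, a * (2 * Real.pi), b * (2 * Real.pi))
      (0, a * (2 * Real.pi), b * (2 * Real.pi)) := by
    apply joined_seg
    intro s hs0 hs1
    simp only [gModel, sub_self, mul_zero, add_zero, Real.cos_int_mul_two_pi, mul_one]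
    apply cos_add_sin_pos <;> nlinarith
  have s3 : JoinedIn sModel (0, a * (2 * Real.pi), b * (2 * Real.pi))
      (0, a * (2 * Real.pi), 0) := by
    apply joined_seg
    intro s hs0 hs1
    simp [gModel, Real.cos_int_mul_two_pi]
  have s4 : JoinedIn sModel (0, a * (2 * Real.pi), 0) (Real.pi / 2, a * (2 * Real.pi), 0) := by
    apply joined_seg
    intro s hs0 hs1
    simp only [gModel, sub_self, mul_zero, add_zero, Real.cos_int_mul_two_pi, mul_one,
      Real.cos_zero]
    apply cos_add_sin_pos <;> nlinarith
  have s5 : JoinedIn sModel (Real.pi / 2, a * (2 * Real.pi), 0) (Real.pi / 2, 0, 0) := by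
    apply joined_seg
    intro s hs0 hs1
    simp [gModel]
  have s6 : JoinedIn sModel (Real.pi / 2, 0, 0) (0, 0, 0) := by
    apply joined_seg
    intro s hs0 hs1
    simp only [gModel, sub_self, mul_zero, add_zero, mul_one, Real.cos_zero]
    apply cos_add_sin_pos <;> nlinarith
  exact ((((s1.trans s2).trans s3).trans s4).trans s5).trans s6

lemma joined_shift {t u v t' u' v' : ℝ} (h : JoinedIn sModel (t, u, v) (t', u', v')) :
    JoinedIn sModel (t + Real.pi / 2, v + Real.pi, u) (t' + Real.pi / 2, v' + Real.pi, u') := by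
  have := h.map (f := fun p : ℝ × ℝ × ℝ => (p.1 + Real.pi / 2, p.2.2 + Real.pi, p.2.1))
    (by fun_prop)
  refine this.mono ?_
  rintro _ ⟨p, hp, rfl⟩
  simp only [sModel, gModel, mem_ofPred_eq, Real.cos_add_pi_div_two, Real.sin_add_pi_div_two,
    Real.cos_add_pi] at hp ⊢
  linarith

lemma joined_unshift {t u v t' u' v' : ℝ} (h : JoinedIn sModel (t, u, v) (t', u', v')) :
    JoinedIn sModel (t - Real.pi / 2, v, u - Real.pi) (t' - Real.pi / 2, v', u' - Real.pi) := by
  have := h.map (f := fun p : ℝ × ℝ × ℝ => (p.1 - Real.pi / 2, p.2.2, p.2.1 - Real.pi))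
    (by fun_prop)
  refine this.mono ?_
  rintro _ ⟨p, hp, rfl⟩
  simp only [sModel, gModel, mem_ofPred_eq, Real.cos_sub_pi_div_two, Real.sin_sub_pi_div_two,
    Real.cos_sub_pi] at hp ⊢
  linarith

lemma joined_base : JoinedIn sModel (0 + Real.pi / 2, 0 + Real.pi, 0) (0, 0, 0) := by
  apply joined_quadrant
  · linarith [Real.pi_pos]
  · linarith
  · simp [gModel]

lemma joined_all (t : ℝ) : ∀ u v : ℝ, 0 < gModel (t, u, v) →
    JoinedIn sModel (t, u, v) (0, 0, 0) := by
  have hper : Function.Periodic (fun t : ℝ => ∀ u v : ℝ, 0 < gModel (t, u, v) →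
    JoinedIn sModel (t, u, v) (0, 0, 0)) (Real.pi / 2) := by
    intro t
    simp only [eq_iff_iff]
    constructor
    · intro H u v h
      have h1 := H (v + Real.pi) u (by
        simp only [gModel, Real.cos_add_pi_div_two, Real.sin_add_pi_div_two,
          Real.cos_add_pi] at h ⊢
        linarith)
      have h2 := joined_unshift h1
      have h3 := joined_unshift joined_base
      simp only [add_sub_cancel_right] at h2 h3
      exact h2.trans h3.symm
    · intro H u v h
      have h1 := H v (u - Real.pi) (by
        simp only [gModel, Real.cos_add_pi_div_two, Real.sin_add_pi_div_two,
          Real.cos_sub_pi] at h ⊢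
        linarith)
      have h2 := joined_shift h1
      simp only [sub_add_cancel] at h2
      exact h2.trans joined_base
  obtain ⟨y, hy, e⟩ := hper.exists_mem_Ico₀ (by linarith [Real.pi_pos]) t
  refine (iff_of_eq e).mpr ?_
  intro u v h
  exact joined_quadrant hy.1 hy.2.le u v h

lemma zero_mem_sModel : ((0, 0, 0) : ℝ × ℝ × ℝ) ∈ sModel := by simp [sModel, gModel]

lemma sModel_pathConnected : IsPathConnected sModel :=
  ⟨(0, 0, 0), zero_mem_sModel, fun {p} hp => (joined_all p.1 p.2.1 p.2.2 hp).symm⟩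

lemma card_two {X A : Type*} [TopologicalSpace X] [TopologicalSpace A] [PreconnectedSpace A]
    [Nonempty A] (f : X → ℝ) (hf : Continuous f) (h0 : ∀ x, f x ≠ 0)
    (α β : A → X) (hα : Continuous α) (hβ : Continuous β)
    (rα : range α = {x | 0 < f x}) (rβ : range β = {x | f x < 0}) :
    Nat.card (ConnectedComponents X) = 2 := by
  have hcl : IsClopen {x | 0 < f x} := by
    refine ⟨?_, isOpen_lt continuous_const hf⟩
    have : {x | 0 < f x} = {x | 0 ≤ f x} := by
      ext x
      simp only [mem_ofPred_eq]
      exact ⟨fun h => le_of_lt h, fun h => lt_of_le_of_ne h (h0 x).symm⟩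
    rw [this]
    exact isClosed_le continuous_const hf
  have hg := (continuous_boolIndicator_iff_isClopen _).mpr hcl
  have hbij : Function.Bijective hg.connectedComponentsLift := by
    constructor
    · intro x y
      obtain ⟨x, rfl⟩ := ConnectedComponents.surjective_coe x
      obtain ⟨y, rfl⟩ := ConnectedComponents.surjective_coe y
      rw [hg.connectedComponentsLift_apply_coe, hg.connectedComponentsLift_apply_coe,
        ConnectedComponents.coe_eq_coe']
      intro h
      by_cases hy : y ∈ {x | 0 < f x}
      · have hx : x ∈ {x | 0 < f x} := by
          rw [mem_iff_boolIndicator] at hy ⊢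
          rw [h, hy]
        rw [← rα] at hx hy
        exact (isPreconnected_range hα).subset_connectedComponent hy hx
      · have hx : x ∉ {x | 0 < f x} := by
          rw [notMem_iff_boolIndicator] at hy ⊢
          rw [h, hy]
        have hx' : x ∈ {x | f x < 0} := lt_of_le_of_ne (not_lt.mp hx) (h0 x)
        have hy' : y ∈ {x | f x < 0} := lt_of_le_of_ne (not_lt.mp hy) (h0 y)
        rw [← rβ] at hx' hy'
        exact (isPreconnected_range hβ).subset_connectedComponent hy' hx'
    · obtain ⟨a⟩ := ‹Nonempty A›
      intro b
      cases b
      · refine ⟨(β a : X), ?_⟩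
        rw [hg.connectedComponentsLift_apply_coe, ← notMem_iff_boolIndicator]
        have : f (β a) < 0 := show β a ∈ {x | f x < 0} from rβ ▸ mem_range_self a
        exact not_lt.mpr (le_of_lt this)
      · refine ⟨(α a : X), ?_⟩
        rw [hg.connectedComponentsLift_apply_coe, ← mem_iff_boolIndicator]
        exact rα ▸ mem_range_self a
  rw [Nat.card_eq_of_bijective _ hbij]
  simp

lemma fT_continuous (j : Fin 2) (m : ℕ) : Continuous (fT j m) := by
  unfold fT
  split_ifs
  · exact continuous_quot_lift _ (by fun_prop)
  · exact continuous_quot_lift _ (by fun_prop)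

lemma fT_one (m : ℕ) (x : ℝ) : fT 1 m (x : AddCircle (2 * Real.pi)) = Real.cos (m * x) := rfl

lemma fT_zero (m : ℕ) (x : ℝ) : fT 0 m (x : AddCircle (2 * Real.pi)) = Real.sin (m * x) := rfl

/-- Affine reparametrisation of the circle. -/
def affT (a b : ℝ) (t : ℝ) : AddCircle (2 * Real.pi) := ((a * t + b : ℝ) : AddCircle (2 * Real.pi))

lemma affT_continuous (a b : ℝ) : Continuous (affT a b) :=
  (AddCircle.continuous_mk' _).comp (by fun_prop)

lemma affT_surjective {a : ℝ} (ha : a ≠ 0) (b : ℝ) : Function.Surjective (affT a b) := by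
  intro x
  obtain ⟨x, rfl⟩ := QuotientAddGroup.mk_surjective x
  refine ⟨(x - b) / a, ?_⟩
  unfold affT
  congr 1
  field_simp
  ring

lemma exists_param (j : Fin 2) (m : ℕ) (hm : 0 < m) :
    ∃ φ : ℝ → AddCircle (2 * Real.pi), Continuous φ ∧ Function.Surjective φ ∧
      ∀ u, fT j m (φ u) = Real.cos u := by
  have hm' : (m : ℝ) ≠ 0 := by positivity
  fin_cases j
  · refine ⟨affT (1 / m) (Real.pi / 2 / m), affT_continuous _ _,
      affT_surjective (by positivity) _, fun u => ?_⟩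
    refine (fT_zero m _).trans ?_
    rw [← Real.sin_add_pi_div_two]
    congr 1
    field_simp
  · refine ⟨affT (1 / m) 0, affT_continuous _ _, affT_surjective (by positivity) _, fun u => ?_⟩
    refine (fT_one m _).trans ?_
    congr 1
    field_simp
    ring

lemma exists_param₂ (j : Fin 2) (m : ℕ) (hm : 0 < m) (ε : ℝ) (hε : ε = 1 ∨ ε = -1) :
    ∃ φ : ℝ → AddCircle (2 * Real.pi), Continuous φ ∧ Function.Surjective φ ∧
      ∀ t, fT j m (φ t) = Real.cos t ∧ ε * fT (1 - j) m (φ t) = Real.sin t := by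
  have hm' : (m : ℝ) ≠ 0 := by positivity
  have hε0 : ε ≠ 0 := by rcases hε with rfl | rfl <;> norm_num
  fin_cases j
  · refine ⟨affT (-ε / m) (Real.pi / 2 / m), affT_continuous _ _,
      affT_surjective (div_ne_zero (neg_ne_zero.mpr hε0) hm') _, fun t => ?_⟩
    have e : (m : ℝ) * (-ε / m * t + Real.pi / 2 / m) = Real.pi / 2 - ε * t := by
      field_simp
      ring
    refine ⟨(fT_zero m _).trans ?_, (congrArg (ε * ·) (fT_one m _)).trans ?_⟩
    · rw [e, Real.sin_pi_div_two_sub]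
      rcases hε with rfl | rfl <;> simp
    · rw [e, Real.cos_pi_div_two_sub]
      rcases hε with rfl | rfl <;> simp
  · refine ⟨affT (ε / m) 0, affT_continuous _ _,
      affT_surjective (div_ne_zero hε0 hm') _, fun t => ?_⟩
    have e : (m : ℝ) * (ε / m * t + 0) = ε * t := by
      field_simp
      ring
    refine ⟨(fT_one m _).trans ?_, (congrArg (ε * ·) (fT_zero m _)).trans ?_⟩
    · rw [e]
      rcases hε with rfl | rfl <;> simp
    · rw [e]
      rcases hε with rfl | rfl <;> simp

/-- Case 2 of the paper's eigenbasis of the flat 3-torus: for distinct positive integers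
`m₁ ≠ m₂`, indices `j₁, j₂, j₃ ∈ {0,1}` and a sign `ε = ±1`, the function
`F(x₁,x₂,x₃) = f_{j₁}(m₁x₁) f_{j₂}(m₂x₂) + ε f_{1-j₁}(m₁x₁) f_{j₃}(m₂x₃)` on `T³`
has exactly two nodal domains. -/
theorem stmt9 (m₁ m₂ : ℕ) (h₁ : 0 < m₁) (h₂ : 0 < m₂) (hne : m₁ ≠ m₂)
    (j₁ j₂ j₃ : Fin 2) (ε : ℝ) (hε : ε = 1 ∨ ε = -1) :
    Nat.card (ConnectedComponents
      {p : T3 // fT j₁ m₁ p.1 * fT j₂ m₂ p.2.1 +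
        ε * (fT (1 - j₁) m₁ p.1 * fT j₃ m₂ p.2.2) ≠ 0}) = 2 := by
  obtain ⟨φ₁, c₁, s₁, e₁⟩ := exists_param₂ j₁ m₁ h₁ ε hε
  obtain ⟨φ₂, c₂, s₂, e₂⟩ := exists_param j₂ m₂ h₂
  obtain ⟨φ₃, c₃, s₃, e₃⟩ := exists_param j₃ m₂ h₂
  set F : T3 → ℝ := fun p => fT j₁ m₁ p.1 * fT j₂ m₂ p.2.1 +
        ε * (fT (1 - j₁) m₁ p.1 * fT j₃ m₂ p.2.2) with hF
  have hFc : Continuous F := by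
    have k1 := fT_continuous j₁ m₁
    have k2 := fT_continuous j₂ m₂
    have k3 := fT_continuous (1 - j₁) m₁
    have k4 := fT_continuous j₃ m₂
    fun_prop
  have hG : ∀ t u v, F (φ₁ t, φ₂ u, φ₃ v) = gModel (t, u, v) := by
    intro t u v
    simp only [hF, gModel, ← (e₁ t).1, ← (e₁ t).2, ← e₂ u, ← e₃ v]
    ring
  have hG' : ∀ t u v, F (φ₁ (t + Real.pi), φ₂ u, φ₃ v) = - gModel (t, u, v) := by
    intro t u v
    rw [hG]
    simp only [gModel, Real.cos_add_pi, Real.sin_add_pi]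
    ring
  haveI : PathConnectedSpace sModel :=
    isPathConnected_iff_pathConnectedSpace.mp sModel_pathConnected
  have hpos : ∀ a : sModel, 0 < gModel (a.1.1, a.1.2.1, a.1.2.2) := fun a => a.2
  refine card_two (X := {p : T3 // F p ≠ 0}) (A := sModel) (fun x => F x.1)
    (hFc.comp continuous_subtype_val) (fun x => x.2)
    (fun a => ⟨(φ₁ a.1.1, φ₂ a.1.2.1, φ₃ a.1.2.2), by rw [hG]; exact (hpos a).ne'⟩)
    (fun a => ⟨(φ₁ (a.1.1 + Real.pi), φ₂ a.1.2.1, φ₃ a.1.2.2), by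
      rw [hG']; exact neg_ne_zero.mpr (hpos a).ne'⟩)
    (by fun_prop) (by fun_prop) ?_ ?_
  · ext ⟨⟨x, y, z⟩, hx⟩
    constructor
    · rintro ⟨a, ha⟩
      rw [← ha]
      simp only [mem_ofPred_eq, hG]
      exact hpos a
    · intro h
      obtain ⟨t, rfl⟩ := s₁ x
      obtain ⟨u, rfl⟩ := s₂ y
      obtain ⟨v, rfl⟩ := s₃ z
      simp only [mem_ofPred_eq, hG] at h
      exact ⟨⟨(t, u, v), h⟩, rfl⟩
  · ext ⟨⟨x, y, z⟩, hx⟩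
    constructor
    · rintro ⟨a, ha⟩
      rw [← ha]
      simp only [mem_ofPred_eq, hG']
      exact neg_neg_of_pos (hpos a)
    · intro h
      obtain ⟨t, rfl⟩ := s₁ x
      obtain ⟨u, rfl⟩ := s₂ y
      obtain ⟨v, rfl⟩ := s₃ z
      obtain ⟨t, rfl⟩ : ∃ t', t = t' + Real.pi := ⟨t - Real.pi, by ring⟩
      simp only [mem_ofPred_eq, hG'] at h
      exact ⟨⟨(t, u, v), neg_neg_iff_pos.mp h⟩, rfl⟩
end
end

section
/- There exist a Hilbert (orthonormal) basis (b_n)_{n∈ℕ} of the real Hilbert space L²(T³) (with respect to Haar measure on T³), continuous functions u_n : T³ → ℝ, and real numbers λ_n ≥ 0, such that: b_n is the L²-equivalence class of u_n for every n; the 2π-periodic lift ũ_n : ℝ³ → ℝ of u_n is smooth and satisfies ∂²ũ_n/∂x₁² + ∂²ũ_n/∂x₂² + ∂²ũ_n/∂x₃² = −λ_n·ũ_n (so each u_n is a Laplacian eigenfunction); and for every n such that u_n is nonconstant, the open set {p ∈ T³ : u_n(p) ≠ 0} has exactly two connected components. -/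
noncomputable section

open MeasureTheory

instance : Fact (0 < 2 * Real.pi) := ⟨by positivity⟩


namespace Nodal

/-! ### Connectivity of the model domain -/

lemma cos_climb (x : ℝ) : ∃ y : ℝ, Real.cos y = 1 ∧
    ∀ t ∈ segment ℝ x y, Real.cos x ≤ Real.cos t := by
  refine ⟨round (x / (2 * Real.pi)) * (2 * Real.pi), ?_, ?_⟩
  · exact Real.cos_int_mul_two_pi (round (x / (2 * Real.pi)))
  · set n : ℤ := round (x / (2 * Real.pi)) with hn
    intro t ht
    have hpi := Real.pi_pos
    have h1 : |x - n * (2 * Real.pi)| ≤ Real.pi := by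
      have h := abs_sub_round (x / (2 * Real.pi))
      rw [← hn] at h
      have h2 : x - n * (2 * Real.pi) = (x / (2 * Real.pi) - n) * (2 * Real.pi) := by
        field_simp
      rw [h2, abs_mul, abs_of_pos (by positivity : (0:ℝ) < 2 * Real.pi)]
      nlinarith
    have h2 : |t - n * (2 * Real.pi)| ≤ |x - n * (2 * Real.pi)| := by
      obtain ⟨a, b, ha, hb, hab, rfl⟩ := ht
      have : a • x + b • ((n:ℝ) * (2 * Real.pi)) - n * (2 * Real.pi)
          = a * (x - n * (2 * Real.pi)) := by
        simp only [smul_eq_mul]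
        have : b = 1 - a := by linarith
        rw [this]; ring
      rw [this, abs_mul, abs_of_nonneg ha]
      nlinarith [abs_nonneg (x - n * (2 * Real.pi))]
    have e : ∀ s : ℝ, Real.cos s = Real.cos |s - n * (2 * Real.pi)| := by
      intro s
      rw [Real.cos_abs, Real.cos_sub_int_mul_two_pi]
    rw [e x, e t]
    exact Real.cos_le_cos_of_nonneg_of_le_pi (abs_nonneg _) h1 h2

lemma climb (A x : ℝ) : ∃ y : ℝ, A * Real.cos y = |A| ∧
    ∀ t ∈ segment ℝ x y, A * Real.cos x ≤ A * Real.cos t := by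
  rcases le_total 0 A with hA | hA
  · obtain ⟨y, hy, h⟩ := cos_climb x
    refine ⟨y, by rw [hy, abs_of_nonneg hA, mul_one], fun t ht => ?_⟩
    exact mul_le_mul_of_nonneg_left (h t ht) hA
  · obtain ⟨y, hy, h⟩ := cos_climb (x + Real.pi)
    refine ⟨y - Real.pi, ?_, fun t ht => ?_⟩
    · rw [Real.cos_sub_pi, hy, abs_of_nonpos hA]; ring
    · have := h (t + Real.pi) (by
        obtain ⟨a, b, ha, hb, hab, rfl⟩ := ht
        refine ⟨a, b, ha, hb, hab, ?_⟩
        simp only [smul_eq_mul]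
        have : b = 1 - a := by linarith
        rw [this]; ring)
      rw [Real.cos_add_pi, Real.cos_add_pi] at this
      nlinarith

lemma mul_cos_ge (A x : ℝ) : -|A| ≤ A * Real.cos x := by
  have h : |A * Real.cos x| ≤ |A| := by
    rw [abs_mul]
    exact mul_le_of_le_one_right (abs_nonneg _) (Real.abs_cos_le_one x)
  exact (abs_le.1 h).1

lemma join1 {S : Set (ℝ × ℝ × ℝ)} {x x' y z : ℝ}
    (h : ∀ t ∈ segment ℝ x x', (t, y, z) ∈ S) : JoinedIn S (x, y, z) (x', y, z) := by
  apply JoinedIn.of_segment_subset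
  rintro ⟨p, q, r⟩ ⟨a, b, ha, hb, hab, e⟩
  simp only [Prod.smul_mk, Prod.mk_add_mk, Prod.mk.injEq, smul_eq_mul] at e
  obtain ⟨e1, e2, e3⟩ := e
  have hq : q = y := by rw [← e2, ← add_mul, hab, one_mul]
  have hr : r = z := by rw [← e3, ← add_mul, hab, one_mul]
  rw [hq, hr]
  exact h p ⟨a, b, ha, hb, hab, e1⟩

lemma join2 {S : Set (ℝ × ℝ × ℝ)} {x y y' z : ℝ}
    (h : ∀ t ∈ segment ℝ y y', (x, t, z) ∈ S) : JoinedIn S (x, y, z) (x, y', z) := by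
  apply JoinedIn.of_segment_subset
  rintro ⟨p, q, r⟩ ⟨a, b, ha, hb, hab, e⟩
  simp only [Prod.smul_mk, Prod.mk_add_mk, Prod.mk.injEq, smul_eq_mul] at e
  obtain ⟨e1, e2, e3⟩ := e
  have hq : p = x := by rw [← e1, ← add_mul, hab, one_mul]
  have hr : r = z := by rw [← e3, ← add_mul, hab, one_mul]
  rw [hq, hr]
  exact h q ⟨a, b, ha, hb, hab, e2⟩

lemma join3 {S : Set (ℝ × ℝ × ℝ)} {x y z z' : ℝ}
    (h : ∀ t ∈ segment ℝ z z', (x, y, t) ∈ S) : JoinedIn S (x, y, z) (x, y, z') := by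
  apply JoinedIn.of_segment_subset
  rintro ⟨p, q, r⟩ ⟨a, b, ha, hb, hab, e⟩
  simp only [Prod.smul_mk, Prod.mk_add_mk, Prod.mk.injEq, smul_eq_mul] at e
  obtain ⟨e1, e2, e3⟩ := e
  have hq : p = x := by rw [← e1, ← add_mul, hab, one_mul]
  have hr : q = y := by rw [← e2, ← add_mul, hab, one_mul]
  rw [hq, hr]
  exact h r ⟨a, b, ha, hb, hab, e3⟩

/-- The domain `{A cos X + B cos Y + C cos Z > 0}` in `ℝ³`. -/
def dom (A B C : ℝ) : Set (ℝ × ℝ × ℝ) :=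
  {v | 0 < A * Real.cos v.1 + B * Real.cos v.2.1 + C * Real.cos v.2.2}

lemma dom_conn {A B C : ℝ} (h1 : |A| < |B| + |C|) (h2 : |B| < |A| + |C|)
    (h3 : |C| < |A| + |B|) : IsConnected (dom A B C) := by
  apply IsPathConnected.isConnected
  obtain ⟨x0, hx0, -⟩ := climb A 0
  obtain ⟨y0, hy0, -⟩ := climb B 0
  obtain ⟨z0, hz0, -⟩ := climb C 0
  refine ⟨(x0, y0, z0), ?_, ?_⟩
  · simp only [dom, Set.mem_ofPred_eq]
    linarith
  · rintro ⟨x, y, z⟩ h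
    simp only [dom, Set.mem_ofPred_eq] at h
    obtain ⟨x1, hx1, kx⟩ := climb A x
    obtain ⟨y1, hy1, ky⟩ := climb B y
    obtain ⟨z1, hz1, kz⟩ := climb C z
    have ex := kx x1 (right_mem_segment ℝ x x1)
    have ey := ky y1 (right_mem_segment ℝ y y1)
    have s1 : JoinedIn (dom A B C) (x, y, z) (x1, y, z) := join1 fun t ht => by
      simp only [dom, Set.mem_ofPred_eq]
      linarith [kx t ht]
    have s2 : JoinedIn (dom A B C) (x1, y, z) (x1, y1, z) := join2 fun t ht => by
      simp only [dom, Set.mem_ofPred_eq]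
      linarith [ky t ht]
    have s3 : JoinedIn (dom A B C) (x1, y1, z) (x1, y1, z1) := join3 fun t ht => by
      simp only [dom, Set.mem_ofPred_eq]
      linarith [kz t ht]
    have s4 : JoinedIn (dom A B C) (x1, y1, z1) (x0, y1, z1) := join1 fun t ht => by
      simp only [dom, Set.mem_ofPred_eq]
      linarith [mul_cos_ge A t]
    have s5 : JoinedIn (dom A B C) (x0, y1, z1) (x0, y0, z1) := join2 fun t ht => by
      simp only [dom, Set.mem_ofPred_eq]
      linarith [mul_cos_ge B t]
    have s6 : JoinedIn (dom A B C) (x0, y0, z1) (x0, y0, z0) := join3 fun t ht => by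
      simp only [dom, Set.mem_ofPred_eq]
      linarith [mul_cos_ge C t]
    exact (((((s1.trans s2).trans s3).trans s4).trans s5).trans s6).symm

/-! ### Counting components -/

lemma card_comp {X : Type*} [TopologicalSpace X] (f : X → ℝ) (hf : Continuous f)
    (hp : IsConnected {x | 0 < f x}) (hn : IsConnected {x | f x < 0}) :
    Nat.card (ConnectedComponents {x : X // f x ≠ 0}) = 2 := by
  let Y := {x : X // f x ≠ 0}
  let g : Y → Bool := fun y => decide (0 < f y.1)
  have hfc : Continuous (fun y : Y => f y.1) := hf.comp continuous_subtype_val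
  have hg : Continuous g := by
    refine (IsLocallyConstant.iff_exists_open g).2 ?_ |>.continuous
    intro y
    rcases lt_or_gt_of_ne y.2 with h | h
    · refine ⟨{y | f y.1 < 0}, isOpen_lt hfc continuous_const, h, fun z hz => ?_⟩
      simp only [Set.mem_ofPred_eq] at hz
      simp [g, not_lt.2 hz.le, not_lt.2 h.le]
    · refine ⟨{y | 0 < f y.1}, isOpen_lt continuous_const hfc, h, fun z hz => ?_⟩
      simp only [Set.mem_ofPred_eq] at hz
      have h' : 0 < f y.1 := h
      simp [g, hz, h']
  have pull : ∀ S : Set X, IsPreconnected S → (∀ x ∈ S, f x ≠ 0) →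
      IsPreconnected {y : Y | y.1 ∈ S} := by
    intro S hS hS0
    have : Subtype.val '' {y : Y | y.1 ∈ S} = S := by
      ext x
      constructor
      · rintro ⟨y, hy, rfl⟩; exact hy
      · intro hx; exact ⟨⟨x, hS0 x hx⟩, hx, rfl⟩
    have h0 : IsPreconnected (Subtype.val '' {y : Y | y.1 ∈ S}) := by rw [this]; exact hS
    exact (Topology.IsInducing.subtypeVal.isPreconnected_image).1 h0
  have hbij : Function.Bijective hg.connectedComponentsLift := by
    constructor
    · intro a b hab
      obtain ⟨a, rfl⟩ := ConnectedComponents.surjective_coe a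
      obtain ⟨b, rfl⟩ := ConnectedComponents.surjective_coe b
      simp only [Continuous.connectedComponentsLift_apply_coe, g, decide_eq_decide] at hab
      rw [ConnectedComponents.coe_eq_coe']
      rcases lt_or_gt_of_ne a.2 with h | h
      · have hb : f b.1 < 0 :=
          lt_of_le_of_ne (not_lt.1 (fun hb => absurd (hab.2 hb) (not_lt.2 h.le))) b.2
        exact (pull _ hn.isPreconnected (fun x hx => ne_of_lt hx)).subset_connectedComponent hb h
      · exact (pull _ hp.isPreconnected (fun x hx => ne_of_gt hx)).subset_connectedComponent
          (hab.1 h) h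
    · intro c
      obtain ⟨x, hx⟩ := hp.nonempty
      obtain ⟨y, hy⟩ := hn.nonempty
      rcases c with _ | _
      · refine ⟨((⟨y, ne_of_lt hy⟩ : Y) : ConnectedComponents Y), ?_⟩
        rw [Continuous.connectedComponentsLift_apply_coe]
        exact decide_eq_false (not_lt.2 (le_of_lt hy))
      · refine ⟨((⟨x, ne_of_gt hx⟩ : Y) : ConnectedComponents Y), ?_⟩
        rw [Continuous.connectedComponentsLift_apply_coe]
        exact decide_eq_true hx
  rw [Nat.card_eq_of_bijective _ hbij]
  simp

/-! ### Waves -/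

/-- Identify a point of the circle with an angle. -/
def tA (x : AddCircle (2 * Real.pi)) : Real.Angle := x

lemma tA_add (x y) : tA (x + y) = tA x + tA y := rfl
lemma tA_coe (x : ℝ) : tA (x : AddCircle (2 * Real.pi)) = (x : Real.Angle) := rfl
lemma tA_cont : Continuous tA := continuous_id

/-- The character of frequency `k`. -/
def ch (k : ℤ × ℤ × ℤ) (p : T3) : Real.Angle :=
  k.1 • tA p.1 + k.2.1 • tA p.2.1 + k.2.2 • tA p.2.2

lemma ch_cont (k) : Continuous (ch k) := by
  have h1 : Continuous (fun p : T3 => tA p.1) := tA_cont.comp continuous_fst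
  have h2 : Continuous (fun p : T3 => tA p.2.1) :=
    tA_cont.comp (continuous_fst.comp continuous_snd)
  have h3 : Continuous (fun p : T3 => tA p.2.2) :=
    tA_cont.comp (continuous_snd.comp continuous_snd)
  exact ((h1.zsmul k.1).add (h2.zsmul k.2.1)).add (h3.zsmul k.2.2)

lemma ch_add (k l p) : ch (k + l) p = ch k p + ch l p := by
  simp only [ch, Prod.fst_add, Prod.snd_add, add_zsmul]; abel

lemma ch_neg (k p) : ch (-k) p = -ch k p := by
  simp only [ch, Prod.fst_neg, Prod.snd_neg, neg_zsmul]; abel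

lemma ch_sub (k l p) : ch (k - l) p = ch k p - ch l p := by
  rw [sub_eq_add_neg, ch_add, ch_neg, sub_eq_add_neg]

lemma ch_zero (p) : ch 0 p = 0 := by simp [ch]

lemma ch_add_right (k p q) : ch k (p + q) = ch k p + ch k q := by
  simp only [ch, Prod.fst_add, Prod.snd_add, tA_add, zsmul_add]; abel

lemma ch_coe (k : ℤ × ℤ × ℤ) (x y z : ℝ) :
    ch k ((x : AddCircle (2 * Real.pi)), (y : AddCircle (2 * Real.pi)),
      (z : AddCircle (2 * Real.pi))) =
      ((k.1 * x + k.2.1 * y + k.2.2 * z : ℝ) : Real.Angle) := by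
  simp only [ch, tA_coe, Real.Angle.coe_add, Real.Angle.intCast_mul_eq_zsmul]

/-- The Hartley wave `cas (k · x)`. -/
def w (k : ℤ × ℤ × ℤ) : C(T3, ℝ) where
  toFun p := (ch k p).cos + (ch k p).sin
  continuous_toFun := (Real.Angle.continuous_cos.comp (ch_cont k)).add
    (Real.Angle.continuous_sin.comp (ch_cont k))

lemma w_apply (k p) : w k p = (ch k p).cos + (ch k p).sin := rfl

lemma w_coe (k : ℤ × ℤ × ℤ) (x y z : ℝ) :
    w k ((x : AddCircle (2 * Real.pi)), (y : AddCircle (2 * Real.pi)),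
      (z : AddCircle (2 * Real.pi))) =
      Real.cos (k.1 * x + k.2.1 * y + k.2.2 * z) + Real.sin (k.1 * x + k.2.1 * y + k.2.2 * z) := by
  rw [w_apply, ch_coe, Real.Angle.cos_coe, Real.Angle.sin_coe]

lemma w_mul (k l p) : w k p * w l p = (ch (k - l) p).cos + (ch (k + l) p).sin := by
  have h := Real.Angle.cos_sq_add_sin_sq (ch l p)
  rw [ch_sub, ch_add, sub_eq_add_neg, Real.Angle.cos_add, Real.Angle.sin_add,
    Real.Angle.cos_neg, Real.Angle.sin_neg, w_apply, w_apply]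
  ring

lemma cos_eq (k p) : (ch k p).cos = (w k p + w (-k) p) / 2 := by
  rw [w_apply, w_apply, ch_neg, Real.Angle.cos_neg, Real.Angle.sin_neg]; ring

lemma sin_eq (k p) : (ch k p).sin = (w k p - w (-k) p) / 2 := by
  rw [w_apply, w_apply, ch_neg, Real.Angle.cos_neg, Real.Angle.sin_neg]; ring

/-! ### Integrals -/

lemma exists_shift {k : ℤ × ℤ × ℤ} (hk : k ≠ 0) : ∃ q : T3, ch k q = (Real.pi : Real.Angle) := by
  obtain ⟨a, b, c⟩ := k
  have : a ≠ 0 ∨ b ≠ 0 ∨ c ≠ 0 := by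
    by_contra! h
    exact hk (by simp [h.1, h.2.1, h.2.2])
  rcases this with h | h | h
  · refine ⟨((Real.pi / a : ℝ), (0 : ℝ), (0 : ℝ)), ?_⟩
    have : (a : ℝ) ≠ 0 := by exact_mod_cast h
    rw [ch_coe]; congr 1; field_simp; ring
  · refine ⟨((0 : ℝ), (Real.pi / b : ℝ), (0 : ℝ)), ?_⟩
    have : (b : ℝ) ≠ 0 := by exact_mod_cast h
    rw [ch_coe]; congr 1; field_simp; ring
  · refine ⟨((0 : ℝ), (0 : ℝ), (Real.pi / c : ℝ)), ?_⟩
    have : (c : ℝ) ≠ 0 := by exact_mod_cast h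
    rw [ch_coe]; congr 1; field_simp; ring

instance haar2 : (volume : Measure (AddCircle (2 * Real.pi) ×
    AddCircle (2 * Real.pi))).IsAddHaarMeasure :=
  inferInstanceAs ((volume : Measure (AddCircle (2 * Real.pi))).prod
    (volume : Measure (AddCircle (2 * Real.pi)))).IsAddHaarMeasure

instance haar3 : (volume : Measure T3).IsAddHaarMeasure :=
  haveI : MeasurableAdd (AddCircle (2 * Real.pi) × AddCircle (2 * Real.pi)) :=
    ContinuousAdd.measurableAdd
  inferInstanceAs ((volume : Measure (AddCircle (2 * Real.pi))).prod
    (volume : Measure (AddCircle (2 * Real.pi) × AddCircle (2 * Real.pi)))).IsAddHaarMeasure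

lemma integral_zero_of_shift (f : T3 → ℝ) (q : T3) (h : ∀ p, f (p + q) = -f p) :
    ∫ p, f p = 0 := by
  have h1 : ∫ p, f (p + q) = ∫ p, f p := integral_add_right_eq_self f q
  simp only [h, integral_neg] at h1
  linarith

lemma int_cos {k : ℤ × ℤ × ℤ} (hk : k ≠ 0) : ∫ p : T3, (ch k p).cos = 0 := by
  obtain ⟨q, hq⟩ := exists_shift hk
  exact integral_zero_of_shift _ q fun p => by rw [ch_add_right, hq, Real.Angle.cos_add_pi]

lemma int_sin (k : ℤ × ℤ × ℤ) : ∫ p : T3, (ch k p).sin = 0 := by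
  by_cases hk : k = 0
  · simp [hk, ch_zero]
  obtain ⟨q, hq⟩ := exists_shift hk
  exact integral_zero_of_shift _ q fun p => by rw [ch_add_right, hq, Real.Angle.sin_add_pi]

/-- Total volume. -/
def V : ℝ := (volume : Measure T3).real Set.univ

lemma V_pos : 0 < V := by
  unfold V
  rw [measureReal_def]
  refine ENNReal.toReal_pos ?_ (measure_ne_top _ _)
  exact (isOpen_univ.measure_pos volume Set.univ_nonempty).ne'

lemma int_w_mul (k l) : ∫ p : T3, w k p * w l p = if k = l then V else 0 := by
  simp only [w_mul]
  rw [integral_add]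
  · rw [int_sin, add_zero]
    split_ifs with h
    · simp [h, ch_zero, V]
    · exact int_cos (sub_ne_zero.2 h)
  · exact (Real.Angle.continuous_cos.comp (ch_cont _)).integrable_of_hasCompactSupport
      (HasCompactSupport.of_compactSpace _)
  · exact (Real.Angle.continuous_sin.comp (ch_cont _)).integrable_of_hasCompactSupport
      (HasCompactSupport.of_compactSpace _)

/-- The class in `L²` of a continuous function. -/
abbrev toL : C(T3, ℝ) →L[ℝ] Lp ℝ 2 (volume : Measure T3) :=
  ContinuousMap.toLp (E := ℝ) 2 (volume : Measure T3) ℝ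

/-- Normalized waves. -/
def nw (k : ℤ × ℤ × ℤ) : C(T3, ℝ) := (Real.sqrt V)⁻¹ • w k

lemma inner_toL (f g : C(T3, ℝ)) : inner ℝ (toL f) (toL g) = ∫ p, f p * g p := by
  have := ContinuousMap.inner_toLp (𝕜 := ℝ) (volume : Measure T3) f g
  rw [this]
  simp [mul_comm]

lemma nw_orthonormal : Orthonormal ℝ (fun k => toL (nw k)) := by
  rw [orthonormal_iff_ite]
  intro k l
  rw [inner_toL]
  simp only [nw, ContinuousMap.smul_apply, smul_eq_mul]
  have : ∀ p : T3, (Real.sqrt V)⁻¹ * w k p * ((Real.sqrt V)⁻¹ * w l p)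
      = V⁻¹ * (w k p * w l p) := by
    intro p
    have h : (Real.sqrt V)⁻¹ * (Real.sqrt V)⁻¹ = V⁻¹ := by
      rw [← mul_inv, Real.mul_self_sqrt V_pos.le]
    rw [← h]; ring
  simp only [this]
  rw [integral_const_mul, int_w_mul]
  split_ifs
  · exact inv_mul_cancel₀ V_pos.ne'
  · simp

/-! ### Density -/

lemma span_w_mul (x y : C(T3, ℝ)) (hx : x ∈ Submodule.span ℝ (Set.range w))
    (hy : y ∈ Submodule.span ℝ (Set.range w)) : x * y ∈ Submodule.span ℝ (Set.range w) := by
  have hmem : ∀ k, w k ∈ Submodule.span ℝ (Set.range w) := fun k =>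
    Submodule.subset_span ⟨k, rfl⟩
  induction hx using Submodule.span_induction with
  | zero => simp
  | add a b _ _ ha hb => rw [add_mul]; exact Submodule.add_mem _ ha hb
  | smul c a _ ha => rw [smul_mul_assoc]; exact Submodule.smul_mem _ _ ha
  | mem a ha =>
    obtain ⟨k, rfl⟩ := ha
    induction hy using Submodule.span_induction with
    | zero => simp
    | add a b _ _ ha hb => rw [mul_add]; exact Submodule.add_mem _ ha hb
    | smul c a _ ha => rw [mul_smul_comm]; exact Submodule.smul_mem _ _ ha
    | mem a ha =>
      obtain ⟨l, rfl⟩ := ha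
      have : w k * w l = (1 / 2 : ℝ) • (w (k - l) + w (-(k - l)))
          + (1 / 2 : ℝ) • (w (k + l) - w (-(k + l))) := by
        ext p
        simp only [ContinuousMap.mul_apply, ContinuousMap.add_apply, ContinuousMap.smul_apply,
          ContinuousMap.sub_apply, smul_eq_mul]
        rw [w_mul, cos_eq, sin_eq]; ring
      rw [this]
      exact Submodule.add_mem _
        (Submodule.smul_mem _ _ (Submodule.add_mem _ (hmem _) (hmem _)))
        (Submodule.smul_mem _ _ (Submodule.sub_mem _ (hmem _) (hmem _)))

lemma w_zero : w 0 = 1 := by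
  ext p; simp [w_apply, ch_zero]

lemma angle_inj {θ ψ : Real.Angle} (h : θ.cos = ψ.cos) (h' : θ.sin = ψ.sin) : θ = ψ := by
  induction θ using Real.Angle.induction_on
  induction ψ using Real.Angle.induction_on
  simp only [Real.Angle.cos_coe, Real.Angle.sin_coe] at h h'
  exact Real.Angle.cos_sin_inj h h'

lemma w_separates {p q : T3} (h : ∀ k, w k p = w k q) : p = q := by
  have hc : ∀ k, ch k p = ch k q := fun k => angle_inj
    (by rw [cos_eq, cos_eq, h, h]) (by rw [sin_eq, sin_eq, h, h])
  have h1 := hc (1, 0, 0)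
  have h2 := hc (0, 1, 0)
  have h3 := hc (0, 0, 1)
  simp only [ch, one_zsmul, zero_zsmul, add_zero, zero_add] at h1 h2 h3
  exact Prod.ext h1 (Prod.ext h2 h3)

lemma span_w_dense : (Submodule.span ℝ (Set.range w)).topologicalClosure = ⊤ := by
  let A : Subalgebra ℝ C(T3, ℝ) := (Submodule.span ℝ (Set.range w)).toSubalgebra
    (Submodule.subset_span ⟨0, w_zero⟩) span_w_mul
  have hA : A.SeparatesPoints := by
    intro p q hpq
    by_contra! hcon
    refine hpq (w_separates fun k => hcon _ ⟨w k, ?_, rfl⟩)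
    exact Submodule.subset_span ⟨k, rfl⟩
  exact congrArg Subalgebra.toSubmodule
    (ContinuousMap.subalgebra_topologicalClosure_eq_top_of_separatesPoints A hA)

lemma span_nw_dense : (Submodule.span ℝ (Set.range fun k => toL (nw k))).topologicalClosure = ⊤ := by
  have h := (ContinuousMap.toLp_denseRange ℝ (volume : Measure T3) ℝ
    (p := 2) (by simp)).topologicalClosure_map_submodule span_w_dense
  rw [eq_top_iff, ← h]
  apply Submodule.topologicalClosure_mono
  rw [Submodule.map_span_le]
  rintro _ ⟨k, rfl⟩
  have : toL (w k) = (Real.sqrt V) • toL (nw k) := by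
    rw [nw, map_smul, smul_smul, mul_inv_cancel₀ (Real.sqrt_pos.2 V_pos).ne', one_smul]
  exact this ▸ Submodule.smul_mem _ _ (Submodule.subset_span ⟨k, rfl⟩)

/-! ### Combinations of three waves -/

lemma cas_shift (X : ℝ) : Real.cos (X + Real.pi / 4) + Real.sin (X + Real.pi / 4)
    = Real.sqrt 2 * Real.cos X := by
  rw [Real.cos_add, Real.sin_add, Real.cos_pi_div_four, Real.sin_pi_div_four]; ring

/-- Determinant of three frequencies. -/
def det3 (k l m : ℤ × ℤ × ℤ) : ℤ :=
  k.1 * (l.2.1 * m.2.2 - m.2.1 * l.2.2) - k.2.1 * (l.1 * m.2.2 - m.1 * l.2.2)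
    + k.2.2 * (l.1 * m.2.1 - m.1 * l.2.1)

/-- Squared length of a frequency. -/
def nsq (k : ℤ × ℤ × ℤ) : ℤ := k.1 ^ 2 + k.2.1 ^ 2 + k.2.2 ^ 2

lemma pos_conn {A B C : ℝ} (h1 : |A| < |B| + |C|) (h2 : |B| < |A| + |C|)
    (h3 : |C| < |A| + |B|) {k l m : ℤ × ℤ × ℤ} (hd : det3 k l m ≠ 0) :
    IsConnected {p : T3 | 0 < A * w k p + B * w l p + C * w m p} := by
  obtain ⟨a1, b1, c1⟩ := k
  obtain ⟨a2, b2, c2⟩ := l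
  obtain ⟨a3, b3, c3⟩ := m
  simp only [det3] at hd
  have hD : (a1 : ℝ) * (b2 * c3 - b3 * c2) - b1 * (a2 * c3 - a3 * c2)
    + c1 * (a2 * b3 - a3 * b2) ≠ 0 := by exact_mod_cast hd
  set D : ℝ := (a1 : ℝ) * (b2 * c3 - b3 * c2) - b1 * (a2 * c3 - a3 * c2)
    + c1 * (a2 * b3 - a3 * b2) with hDdef
  let φ1 : ℝ × ℝ × ℝ → ℝ := fun v => ((b2 * c3 - b3 * c2) * (v.1 + Real.pi / 4)
    + (b3 * c1 - b1 * c3) * (v.2.1 + Real.pi / 4)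
    + (b1 * c2 - b2 * c1) * (v.2.2 + Real.pi / 4)) / D
  let φ2 : ℝ × ℝ × ℝ → ℝ := fun v => ((c2 * a3 - c3 * a2) * (v.1 + Real.pi / 4)
    + (c3 * a1 - c1 * a3) * (v.2.1 + Real.pi / 4)
    + (c1 * a2 - c2 * a1) * (v.2.2 + Real.pi / 4)) / D
  let φ3 : ℝ × ℝ × ℝ → ℝ := fun v => ((a2 * b3 - a3 * b2) * (v.1 + Real.pi / 4)
    + (a3 * b1 - a1 * b3) * (v.2.1 + Real.pi / 4)
    + (a1 * b2 - a2 * b1) * (v.2.2 + Real.pi / 4)) / D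
  have c1' : Continuous φ1 := by simp only [φ1]; fun_prop
  have c2' : Continuous φ2 := by simp only [φ2]; fun_prop
  have c3' : Continuous φ3 := by simp only [φ3]; fun_prop
  let Φ : ℝ × ℝ × ℝ → T3 := fun v => ((φ1 v : ℝ), (φ2 v : ℝ), (φ3 v : ℝ))
  have hq : Continuous (fun x : ℝ => (x : AddCircle (2 * Real.pi))) :=
    AddCircle.continuous_mk' _
  have hΦ : Continuous Φ := (hq.comp c1').prodMk ((hq.comp c2').prodMk (hq.comp c3'))
  have e1 : ∀ v, (a1 : ℝ) * φ1 v + b1 * φ2 v + c1 * φ3 v = v.1 + Real.pi / 4 := by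
    intro v; simp only [φ1, φ2, φ3]; field_simp; rw [hDdef]; ring
  have e2 : ∀ v, (a2 : ℝ) * φ1 v + b2 * φ2 v + c2 * φ3 v = v.2.1 + Real.pi / 4 := by
    intro v; simp only [φ1, φ2, φ3]; field_simp; rw [hDdef]; ring
  have e3 : ∀ v, (a3 : ℝ) * φ1 v + b3 * φ2 v + c3 * φ3 v = v.2.2 + Real.pi / 4 := by
    intro v; simp only [φ1, φ2, φ3]; field_simp; rw [hDdef]; ring
  have hval : ∀ v, A * w (a1, b1, c1) (Φ v) + B * w (a2, b2, c2) (Φ v)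
      + C * w (a3, b3, c3) (Φ v) = Real.sqrt 2 * (A * Real.cos v.1 + B * Real.cos v.2.1
        + C * Real.cos v.2.2) := by
    intro v
    simp only [Φ, w_coe, e1, e2, e3, cas_shift]
    ring
  have h2pos : 0 < Real.sqrt 2 := by positivity
  have himg : {p : T3 | 0 < A * w (a1, b1, c1) p + B * w (a2, b2, c2) p
      + C * w (a3, b3, c3) p} = Φ '' dom A B C := by
    ext p
    constructor
    · intro hp
      obtain ⟨x, y, z⟩ := p
      obtain ⟨x, rfl⟩ := QuotientAddGroup.mk_surjective x
      obtain ⟨y, rfl⟩ := QuotientAddGroup.mk_surjective y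
      obtain ⟨z, rfl⟩ := QuotientAddGroup.mk_surjective z
      let v : ℝ × ℝ × ℝ := (a1 * x + b1 * y + c1 * z - Real.pi / 4,
        a2 * x + b2 * y + c2 * z - Real.pi / 4, a3 * x + b3 * y + c3 * z - Real.pi / 4)
      have f1 : φ1 v = x := by simp only [φ1, v]; field_simp; rw [hDdef]; ring
      have f2 : φ2 v = y := by simp only [φ2, v]; field_simp; rw [hDdef]; ring
      have f3 : φ3 v = z := by simp only [φ3, v]; field_simp; rw [hDdef]; ring
      have hv : Φ v = (QuotientAddGroup.mk x, QuotientAddGroup.mk y, QuotientAddGroup.mk z) := by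
        simp only [Φ, f1, f2, f3]
      refine ⟨v, ?_, hv⟩
      have hp' : 0 < A * w (a1, b1, c1) (Φ v) + B * w (a2, b2, c2) (Φ v)
        + C * w (a3, b3, c3) (Φ v) := by rw [hv]; exact hp
      rw [hval] at hp'
      exact pos_of_mul_pos_right hp' h2pos.le
    · rintro ⟨v, hv, rfl⟩
      simp only [Set.mem_ofPred_eq]
      rw [hval]
      exact mul_pos h2pos hv
  rw [himg]
  exact (dom_conn h1 h2 h3).image Φ hΦ.continuousOn

lemma nodal {A B C : ℝ} (h1 : |A| < |B| + |C|) (h2 : |B| < |A| + |C|)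
    (h3 : |C| < |A| + |B|) {k l m : ℤ × ℤ × ℤ} (hd : det3 k l m ≠ 0) (f : T3 → ℝ)
    (hf : ∀ p, f p = A * w k p + B * w l p + C * w m p) :
    Nat.card (ConnectedComponents {p : T3 // f p ≠ 0}) = 2 := by
  have hf' : f = fun p => A * w k p + B * w l p + C * w m p := funext hf
  have hc : Continuous f := by rw [hf']; fun_prop
  refine card_comp f hc ?_ ?_
  · rw [hf']; exact pos_conn h1 h2 h3 hd
  · have := pos_conn (A := -A) (B := -B) (C := -C) (by simpa using h1) (by simpa using h2)
      (by simpa using h3) hd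
    convert this using 3 with p
    rw [hf]
    constructor <;> intro h <;> linarith

lemma dd (A B C a b c a' b' c' s : ℝ) :
    deriv (deriv (fun s : ℝ => A * (Real.cos (a * s + a') + Real.sin (a * s + a'))
      + B * (Real.cos (b * s + b') + Real.sin (b * s + b'))
      + C * (Real.cos (c * s + c') + Real.sin (c * s + c')))) s =
    - (A * a ^ 2 * (Real.cos (a * s + a') + Real.sin (a * s + a'))
      + B * b ^ 2 * (Real.cos (b * s + b') + Real.sin (b * s + b'))
      + C * c ^ 2 * (Real.cos (c * s + c') + Real.sin (c * s + c'))) := by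
  have l : ∀ a a' s : ℝ, HasDerivAt (fun s : ℝ => a * s + a') a s := by
    intro a a' s
    simpa using ((hasDerivAt_id s).const_mul a).add_const a'
  have t1 : ∀ A a a' s : ℝ, HasDerivAt
      (fun s : ℝ => A * (Real.cos (a * s + a') + Real.sin (a * s + a')))
      (A * a * (Real.cos (a * s + a') - Real.sin (a * s + a'))) s := by
    intro A a a' s
    exact ((((l a a' s).cos).add ((l a a' s).sin)).const_mul A).congr_deriv (by ring)
  have t2 : ∀ A a a' s : ℝ, HasDerivAt
      (fun s : ℝ => A * (Real.cos (a * s + a') - Real.sin (a * s + a')))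
      (-(A * a * (Real.cos (a * s + a') + Real.sin (a * s + a')))) s := by
    intro A a a' s
    exact ((((l a a' s).cos).sub ((l a a' s).sin)).const_mul A).congr_deriv (by ring)
  have e : deriv (fun s : ℝ => A * (Real.cos (a * s + a') + Real.sin (a * s + a'))
      + B * (Real.cos (b * s + b') + Real.sin (b * s + b'))
      + C * (Real.cos (c * s + c') + Real.sin (c * s + c'))) =
      fun s => A * a * (Real.cos (a * s + a') - Real.sin (a * s + a'))
        + B * b * (Real.cos (b * s + b') - Real.sin (b * s + b'))
        + C * c * (Real.cos (c * s + c') - Real.sin (c * s + c')) := by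
    funext s
    exact (((t1 A a a' s).add (t1 B b b' s)).add (t1 C c c' s)).deriv
  rw [e]
  refine (HasDerivAt.deriv
    (((t2 (A * a) a a' s).add (t2 (B * b) b b' s)).add (t2 (C * c) c c' s))).trans ?_
  ring

/-- A function which is the required kind of eigenfunction. -/
def Nice (u : T3 → ℝ) : Prop :=
  ∃ lam : ℝ, 0 ≤ lam ∧
      (ContDiff ℝ (⊤ : ℕ∞) (fun x : ℝ × ℝ × ℝ =>
        u ((x.1 : AddCircle (2 * Real.pi)), (x.2.1 : AddCircle (2 * Real.pi)),
          (x.2.2 : AddCircle (2 * Real.pi))))) ∧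
      (∀ x y z : ℝ,
        deriv (deriv (fun s : ℝ => u ((s : AddCircle (2 * Real.pi)),
            (y : AddCircle (2 * Real.pi)), (z : AddCircle (2 * Real.pi))))) x +
        deriv (deriv (fun s : ℝ => u ((x : AddCircle (2 * Real.pi)),
            (s : AddCircle (2 * Real.pi)), (z : AddCircle (2 * Real.pi))))) y +
        deriv (deriv (fun s : ℝ => u ((x : AddCircle (2 * Real.pi)),
            (y : AddCircle (2 * Real.pi)), (s : AddCircle (2 * Real.pi))))) z =
          -lam * u ((x : AddCircle (2 * Real.pi)), (y : AddCircle (2 * Real.pi)),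
            (z : AddCircle (2 * Real.pi)))) ∧
      ((¬ ∃ cst : ℝ, ∀ p : T3, u p = cst) →
        Nat.card (ConnectedComponents {p : T3 // u p ≠ 0}) = 2)

lemma nice_const (c : ℝ) (u : T3 → ℝ) (h : ∀ p, u p = c) : Nice u := by
  refine ⟨0, le_rfl, ?_, ?_, fun h' => absurd ⟨c, h⟩ h'⟩
  · simp only [h]; exact contDiff_const
  · intro x y z; simp [h]

lemma nice_three {A B C : ℝ} (h1 : |A| < |B| + |C|) (h2 : |B| < |A| + |C|)
    (h3 : |C| < |A| + |B|) {k l m : ℤ × ℤ × ℤ} (hd : det3 k l m ≠ 0)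
    (hl : nsq l = nsq k) (hm : nsq m = nsq k) (f : T3 → ℝ)
    (hf : ∀ p, f p = A * w k p + B * w l p + C * w m p) : Nice f := by
  refine ⟨nsq k, by unfold nsq; positivity, ?_, ?_, fun _ => nodal h1 h2 h3 hd f hf⟩
  · simp only [hf, w_coe]
    fun_prop
  · intro x y z
    simp only [hf, w_coe]
    have d1 := dd A B C k.1 l.1 m.1 (k.2.1 * y + k.2.2 * z) (l.2.1 * y + l.2.2 * z)
      (m.2.1 * y + m.2.2 * z) x
    have d2 := dd A B C k.2.1 l.2.1 m.2.1 (k.1 * x + k.2.2 * z) (l.1 * x + l.2.2 * z)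
      (m.1 * x + m.2.2 * z) y
    have d3 := dd A B C k.2.2 l.2.2 m.2.2 (k.1 * x + k.2.1 * y) (l.1 * x + l.2.1 * y)
      (m.1 * x + m.2.1 * y) z
    have r1 : ∀ (k : ℤ × ℤ × ℤ) (x : ℝ), (k.1 : ℝ) * x + (k.2.1 * y + k.2.2 * z)
      = k.1 * x + k.2.1 * y + k.2.2 * z := by intros; ring
    have r2 : ∀ (k : ℤ × ℤ × ℤ) (y : ℝ), (k.2.1 : ℝ) * y + (k.1 * x + k.2.2 * z)
      = k.1 * x + k.2.1 * y + k.2.2 * z := by intros; ring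
    have r3 : ∀ (k : ℤ × ℤ × ℤ) (z : ℝ), (k.2.2 : ℝ) * z + (k.1 * x + k.2.1 * y)
      = k.1 * x + k.2.1 * y + k.2.2 * z := by intros; ring
    simp only [r1] at d1
    simp only [r2] at d2
    simp only [r3] at d3
    rw [d1, d2, d3]
    have hl' : ((l.1 : ℝ) ^ 2 + l.2.1 ^ 2 + l.2.2 ^ 2) = nsq k := by
      rw [← hl]; simp [nsq]
    have hm' : ((m.1 : ℝ) ^ 2 + m.2.1 ^ 2 + m.2.2 ^ 2) = nsq k := by
      rw [← hm]; simp [nsq]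
    have hk' : ((k.1 : ℝ) ^ 2 + k.2.1 ^ 2 + k.2.2 ^ 2) = nsq k := by
      simp [nsq]
    generalize Real.cos (k.1 * x + k.2.1 * y + k.2.2 * z)
      + Real.sin (k.1 * x + k.2.1 * y + k.2.2 * z) = P
    generalize Real.cos (l.1 * x + l.2.1 * y + l.2.2 * z)
      + Real.sin (l.1 * x + l.2.1 * y + l.2.2 * z) = Q
    generalize Real.cos (m.1 * x + m.2.1 * y + m.2.2 * z)
      + Real.sin (m.1 * x + m.2.1 * y + m.2.2 * z) = R
    linear_combination (-A * P) * hk' - B * Q * hl' - C * R * hm'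

/-! ### Blocks of frequencies -/

/-- Names of the blocks into which the frequency lattice is partitioned. -/
inductive Blk : Type
  | zero : Blk
  | axis (d : ℤ) (h : d ≠ 0) : Blk
  | planA (a : ℤ) (h : a ≠ 0) (n : ℕ) : Blk
  | planB (a : ℤ) (h : a ≠ 0) (n : ℕ) : Blk
  | full (a : ℤ) (h : a ≠ 0) (m n : ℕ) : Blk

/-- Size of a block. -/
def sz : Blk → ℕ
  | .zero => 1
  | .axis _ _ => 3
  | .planA _ _ _ => 3
  | .planB _ _ _ => 3
  | .full _ _ _ _ => 4

/-- The members of a block. -/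
def pos : (b : Blk) → Fin (sz b) → ℤ × ℤ × ℤ
  | .zero => ![(0, 0, 0)]
  | .axis d _ => ![(d, 0, 0), (0, d, 0), (0, 0, d)]
  | .planA a _ n => ![(a, (n + 1 : ℤ), 0), (a, -(n + 1 : ℤ), 0), (0, a, (n + 1 : ℤ))]
  | .planB a _ n => ![(0, a, -(n + 1 : ℤ)), ((n + 1 : ℤ), 0, a), (-(n + 1 : ℤ), 0, a)]
  | .full a _ m n => ![(a, (m + 1 : ℤ), (n + 1 : ℤ)), (a, -(m + 1 : ℤ), (n + 1 : ℤ)),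
      (a, (m + 1 : ℤ), -(n + 1 : ℤ)), (a, -(m + 1 : ℤ), -(n + 1 : ℤ))]

/-- The `3 × 3` mixing matrix. -/
def M3 : Matrix (Fin 3) (Fin 3) ℝ := !![2/3, 2/3, -1/3; 2/3, -1/3, 2/3; -1/3, 2/3, 2/3]

/-- The `4 × 4` mixing matrix. -/
def M4 : Matrix (Fin 4) (Fin 4) ℝ :=
  !![0, 1/3, 2/3, 2/3; -1/3, 0, -2/3, 2/3; -2/3, 2/3, 0, -1/3; -2/3, -2/3, 1/3, 0]

lemma M3_orth : M3 * M3.transpose = 1 := by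
  ext i j
  fin_cases i <;> fin_cases j <;> simp [M3, Matrix.mul_apply, Fin.sum_univ_succ] <;> norm_num

lemma M4_orth : M4 * M4.transpose = 1 := by
  ext i j
  fin_cases i <;> fin_cases j <;> simp [M4, Matrix.mul_apply, Fin.sum_univ_succ] <;> norm_num

/-- The mixing matrix of a block. -/
def Mb : (b : Blk) → Matrix (Fin (sz b)) (Fin (sz b)) ℝ
  | .zero => (1 : Matrix (Fin 1) (Fin 1) ℝ)
  | .axis _ _ => M3
  | .planA _ _ _ => M3
  | .planB _ _ _ => M3
  | .full _ _ _ _ => M4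

lemma Mb_orth (b : Blk) : Mb b * (Mb b).transpose = 1 := by
  cases b
  · exact (by simp : (1 : Matrix (Fin 1) (Fin 1) ℝ) * (1 : Matrix (Fin 1) (Fin 1) ℝ).transpose = 1)
  · exact M3_orth
  · exact M3_orth
  · exact M3_orth
  · exact M4_orth

/-- Entries of the mixing matrix. -/
def Me (b : Blk) (i j : Fin (sz b)) : ℝ := Mb b i j

lemma Me_row (b : Blk) (i j : Fin (sz b)) :
    ∑ l, Me b i l * Me b j l = if i = j then 1 else 0 := by
  have h := congrFun (congrFun (Mb_orth b) i) j
  rw [Matrix.mul_apply, Matrix.one_apply] at h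
  exact h

lemma Me_col (b : Blk) (i j : Fin (sz b)) :
    ∑ l, Me b l i * Me b l j = if i = j then 1 else 0 := by
  have hT : (Mb b).transpose * Mb b = 1 := mul_eq_one_comm.1 (Mb_orth b)
  have h := congrFun (congrFun hT i) j
  rw [Matrix.mul_apply, Matrix.one_apply] at h
  exact h

/-- Index type. -/
abbrev Idx := Σ b : Blk, Fin (sz b)

/-- The frequency of an index. -/
def fr (i : Idx) : ℤ × ℤ × ℤ := pos i.1 i.2

lemma fr_surj : Function.Surjective fr := by
  rintro ⟨x, y, z⟩
  have key : ∀ t : ℤ, t ≠ 0 → ∃ n : ℕ, t = (n + 1 : ℤ) ∨ t = -(n + 1 : ℤ) := by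
    intro t ht
    refine ⟨t.natAbs - 1, ?_⟩
    omega
  by_cases hx : x = 0 <;> by_cases hy : y = 0 <;> by_cases hz : z = 0
  · subst hx hy hz; exact ⟨⟨.zero, (0 : Fin 1)⟩, rfl⟩
  · subst hx hy; exact ⟨⟨.axis z hz, (2 : Fin 3)⟩, rfl⟩
  · subst hx hz; exact ⟨⟨.axis y hy, (1 : Fin 3)⟩, rfl⟩
  · subst hx
    obtain ⟨n, rfl | rfl⟩ := key z hz
    · exact ⟨⟨.planA y hy n, (2 : Fin 3)⟩, rfl⟩
    · exact ⟨⟨.planB y hy n, (0 : Fin 3)⟩, rfl⟩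
  · subst hy hz; exact ⟨⟨.axis x hx, (0 : Fin 3)⟩, rfl⟩
  · subst hy
    obtain ⟨n, rfl | rfl⟩ := key x hx
    · exact ⟨⟨.planB z hz n, (1 : Fin 3)⟩, rfl⟩
    · exact ⟨⟨.planB z hz n, (2 : Fin 3)⟩, rfl⟩
  · subst hz
    obtain ⟨n, rfl | rfl⟩ := key y hy
    · exact ⟨⟨.planA x hx n, (0 : Fin 3)⟩, rfl⟩
    · exact ⟨⟨.planA x hx n, (1 : Fin 3)⟩, rfl⟩
  · obtain ⟨m, rfl | rfl⟩ := key y hy <;> obtain ⟨n, rfl | rfl⟩ := key z hz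
    · exact ⟨⟨.full x hx m n, (0 : Fin 4)⟩, rfl⟩
    · exact ⟨⟨.full x hx m n, (2 : Fin 4)⟩, rfl⟩
    · exact ⟨⟨.full x hx m n, (1 : Fin 4)⟩, rfl⟩
    · exact ⟨⟨.full x hx m n, (3 : Fin 4)⟩, rfl⟩

/-- A left inverse of `fr`. -/
def dec (v : ℤ × ℤ × ℤ) : Idx :=
  if hx : v.1 = 0 then
    if hy : v.2.1 = 0 then
      if hz : v.2.2 = 0 then ⟨.zero, (0 : Fin 1)⟩ else ⟨.axis v.2.2 hz, (2 : Fin 3)⟩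
    else
      if v.2.2 = 0 then ⟨.axis v.2.1 hy, (1 : Fin 3)⟩
      else if 0 < v.2.2 then ⟨.planA v.2.1 hy (v.2.2.natAbs - 1), (2 : Fin 3)⟩
      else ⟨.planB v.2.1 hy (v.2.2.natAbs - 1), (0 : Fin 3)⟩
  else
    if v.2.1 = 0 then
      if hz : v.2.2 = 0 then ⟨.axis v.1 hx, (0 : Fin 3)⟩
      else if 0 < v.1 then ⟨.planB v.2.2 hz (v.1.natAbs - 1), (1 : Fin 3)⟩
      else ⟨.planB v.2.2 hz (v.1.natAbs - 1), (2 : Fin 3)⟩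
    else
      if v.2.2 = 0 then
        if 0 < v.2.1 then ⟨.planA v.1 hx (v.2.1.natAbs - 1), (0 : Fin 3)⟩
        else ⟨.planA v.1 hx (v.2.1.natAbs - 1), (1 : Fin 3)⟩
      else
        ⟨.full v.1 hx (v.2.1.natAbs - 1) (v.2.2.natAbs - 1),
          if 0 < v.2.1 then (if 0 < v.2.2 then (0 : Fin 4) else (2 : Fin 4))
          else (if 0 < v.2.2 then (1 : Fin 4) else (3 : Fin 4))⟩

lemma dec_fr (i : Idx) : dec (fr i) = i := by
  have e1 : ∀ n : ℕ, (n : ℤ) + 1 ≠ 0 := by intro n; omega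
  have e2 : ∀ n : ℕ, -1 + -(n : ℤ) ≠ 0 := by intro n; omega
  have e3 : ∀ n : ℕ, (0 : ℤ) < n + 1 := by intro n; omega
  have e4 : ∀ n : ℕ, ¬ (0 : ℤ) < -1 + -(n : ℤ) := by intro n; omega
  have cA : ∀ (a : ℤ) (h : a ≠ 0) (n' n : ℕ) (j : Fin 3), n' = n →
      (⟨.planA a h n', j⟩ : Idx) = ⟨.planA a h n, j⟩ := by rintro a h n' n j rfl; rfl
  have cB : ∀ (a : ℤ) (h : a ≠ 0) (n' n : ℕ) (j : Fin 3), n' = n →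
      (⟨.planB a h n', j⟩ : Idx) = ⟨.planB a h n, j⟩ := by rintro a h n' n j rfl; rfl
  have cF : ∀ (a : ℤ) (h : a ≠ 0) (m' m n' n : ℕ) (j : Fin 4), m' = m → n' = n →
      (⟨.full a h m' n', j⟩ : Idx) = ⟨.full a h m n, j⟩ := by rintro a h m' m n' n j rfl rfl; rfl
  obtain ⟨b, j⟩ := i
  cases b with
  | zero => change Fin 1 at j; fin_cases j; simp [fr, pos, dec]
  | axis d h => change Fin 3 at j; fin_cases j <;> simp [fr, pos, dec, h]
  | planA a h n =>
    change Fin 3 at j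
    fin_cases j <;> simp [fr, pos, dec, h, e1, e2, e3, e4] <;> exact cA _ _ _ _ _ (by omega)
  | planB a h n =>
    change Fin 3 at j
    fin_cases j <;> simp [fr, pos, dec, h, e1, e2, e3, e4] <;> exact cB _ _ _ _ _ (by omega)
  | full a h m n =>
    change Fin 4 at j
    fin_cases j <;> simp [fr, pos, dec, h, e1, e2, e3, e4] <;>
      exact cF _ _ _ _ _ _ _ (by omega) (by omega)

lemma fr_inj : Function.Injective fr := Function.LeftInverse.injective dec_fr

/-! ### The basis functions -/

/-- The basis functions. -/
def bf (i : Idx) : C(T3, ℝ) := ∑ j, Me i.1 i.2 j • nw (pos i.1 j)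

lemma toL_bf (i : Idx) : toL (bf i) = ∑ j, Me i.1 i.2 j • toL (nw (pos i.1 j)) := by
  simp [bf, map_sum]

lemma toL_bf' (b : Blk) (i : Fin (sz b)) :
    toL (bf ⟨b, i⟩) = ∑ j : Fin (sz b), Me b i j • toL (nw (pos b j)) := toL_bf ⟨b, i⟩

lemma bf_orthonormal : Orthonormal ℝ (fun i => toL (bf i)) := by
  classical
  rw [orthonormal_iff_ite]
  rintro ⟨b, i⟩ ⟨c, j⟩
  have hw := orthonormal_iff_ite.1 nw_orthonormal
  simp only [toL_bf', sum_inner, inner_sum, inner_smul_left, inner_smul_right, hw]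
  by_cases hbc : b = c
  · subst hbc
    have hpi : Function.Injective (pos b) := by
      intro x y hxy
      have := @fr_inj ⟨b, x⟩ ⟨b, y⟩ hxy
      simpa using this
    simp only [hpi.eq_iff, mul_ite, mul_one, mul_zero]
    have h := Me_row b i j
    simp only [Sigma.mk.injEq, heq_eq_eq, true_and]
    rw [← h]
    simp [mul_comm]
  · have hne : ∀ x y, pos b x ≠ pos c y := by
      intro x y hxy
      have := @fr_inj ⟨b, x⟩ ⟨c, y⟩ hxy
      exact hbc (congrArg Sigma.fst this)
    simp [hne, hbc]

lemma bf_dense : ⊤ ≤ (Submodule.span ℝ (Set.range fun i => toL (bf i))).topologicalClosure := by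
  rw [← span_nw_dense]
  apply Submodule.topologicalClosure_mono
  rw [Submodule.span_le]
  rintro _ ⟨k, rfl⟩
  obtain ⟨⟨b, j⟩, rfl⟩ := fr_surj k
  have : toL (nw (fr ⟨b, j⟩)) = ∑ i, Me b i j • toL (bf ⟨b, i⟩) := by
    simp only [toL_bf', Finset.smul_sum, smul_smul]
    rw [Finset.sum_comm]
    simp only [← Finset.sum_smul]
    simp [Me_col, fr]
  simp only [SetLike.mem_coe]
  rw [this]
  exact Submodule.sum_mem _ fun i _ => Submodule.smul_mem _ _ (Submodule.subset_span ⟨_, rfl⟩)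

lemma tri {c s : ℝ} (hc : 0 < c) {A B C : ℝ} (_ : s = 1)
    (h : |A| < |B| + |C| ∧ |B| < |A| + |C| ∧ |C| < |A| + |B|) :
    |c * A| < |c * B| + |c * C| ∧ |c * B| < |c * A| + |c * C| ∧ |c * C| < |c * A| + |c * B| := by
  simp only [abs_mul, abs_of_pos hc, ← mul_add]
  exact ⟨mul_lt_mul_of_pos_left h.1 hc, mul_lt_mul_of_pos_left h.2.1 hc,
    mul_lt_mul_of_pos_left h.2.2 hc⟩

lemma nice_row {A B C : ℝ} (h : |A| < |B| + |C| ∧ |B| < |A| + |C| ∧ |C| < |A| + |B|)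
    {k l m : ℤ × ℤ × ℤ} (hd : det3 k l m ≠ 0)
    (hl : nsq l = nsq k) (hm : nsq m = nsq k) (f : C(T3, ℝ))
    (hf : f = A • nw k + B • nw l + C • nw m) : Nice f := by
  have hc : 0 < (Real.sqrt V)⁻¹ := inv_pos.2 (Real.sqrt_pos.2 V_pos)
  obtain ⟨h1, h2, h3⟩ := tri (s := 1) hc rfl h
  refine nice_three h1 h2 h3 hd hl hm _ fun p => ?_
  rw [hf]
  simp only [nw, ContinuousMap.add_apply, ContinuousMap.smul_apply, smul_eq_mul]
  ring

lemma nice3 {k l m : ℤ × ℤ × ℤ} (hd : det3 k l m ≠ 0)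
    (hl : nsq l = nsq k) (hm : nsq m = nsq k) (i : Fin 3) :
    Nice (∑ j, M3 i j • nw (![k, l, m] j) : C(T3, ℝ)) := by
  rw [Fin.sum_univ_three]
  refine nice_row ?_ hd hl hm _ rfl
  fin_cases i <;> simp [M3, abs_div] <;> norm_num

lemma nice4 {k l m n : ℤ × ℤ × ℤ} (h0 : det3 l m n ≠ 0) (h1 : det3 k m n ≠ 0)
    (h2 : det3 k l n ≠ 0) (h3 : det3 k l m ≠ 0)
    (hl : nsq l = nsq k) (hm : nsq m = nsq k) (hn : nsq n = nsq k) (i : Fin 4) :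
    Nice (∑ j, M4 i j • nw (![k, l, m, n] j) : C(T3, ℝ)) := by
  rw [Fin.sum_univ_four]
  fin_cases i
  · refine nice_row (A := 1/3) (B := 2/3) (C := 2/3) ?_ h0 (hm.trans hl.symm) (hn.trans hl.symm)
      _ ?_
    · norm_num [abs_div]
    · simp [M4]
  · refine nice_row (A := -1/3) (B := -2/3) (C := 2/3) ?_ h1 hm hn _ ?_
    · norm_num [abs_div]
    · simp [M4]
  · refine nice_row (A := -2/3) (B := 2/3) (C := -1/3) ?_ h2 hl hn _ ?_
    · norm_num [abs_div]
    · simp [M4]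
  · refine nice_row (A := -2/3) (B := -2/3) (C := 1/3) ?_ h3 hl hm _ ?_
    · norm_num [abs_div]
    · simp [M4]

lemma bf_nice (i : Idx) : Nice (bf i) := by
  obtain ⟨b, j⟩ := i
  have e1 : ∀ n : ℕ, (n : ℤ) + 1 ≠ 0 := by intro n; omega
  cases b with
  | zero =>
    change Fin 1 at j
    refine nice_const (Real.sqrt V)⁻¹ _ fun p => ?_
    have : bf ⟨.zero, j⟩ = ∑ l : Fin 1, (1 : Matrix (Fin 1) (Fin 1) ℝ) j l • nw (![(0, 0, 0)] l) :=
      rfl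
    rw [this]
    have hw : w (0, 0, 0) p = 1 := congrArg (fun f : C(T3, ℝ) => f p) w_zero
    obtain rfl : j = 0 := Subsingleton.elim _ _
    simp [nw, hw]
  | axis d h =>
    refine nice3 (k := (d, 0, 0)) (l := (0, d, 0)) (m := (0, 0, d)) ?_ ?_ ?_ j
    · simp [det3, h]
    · simp [nsq]
    · simp [nsq]
  | planA a h n =>
    refine nice3 (k := (a, (n + 1 : ℤ), 0)) (l := (a, -(n + 1 : ℤ), 0))
      (m := (0, a, (n + 1 : ℤ))) ?_ ?_ ?_ j
    · have : -2 * a * (n + 1 : ℤ) ^ 2 ≠ 0 := by simp [h, e1]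
      convert this using 1
      simp only [det3]; ring
    · simp only [nsq]; ring
    · simp only [nsq]; ring
  | planB a h n =>
    refine nice3 (k := (0, a, -(n + 1 : ℤ))) (l := ((n + 1 : ℤ), 0, a))
      (m := (-(n + 1 : ℤ), 0, a)) ?_ ?_ ?_ j
    · have : -2 * a ^ 2 * (n + 1 : ℤ) ≠ 0 := by simp [h, e1]
      convert this using 1
      simp only [det3]; ring
    · simp only [nsq]; ring
    · simp only [nsq]; ring
  | full a h m n =>
    have hp : 4 * a * (m + 1 : ℤ) * (n + 1 : ℤ) ≠ 0 := by simp [h, e1]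
    refine nice4 (k := (a, (m + 1 : ℤ), (n + 1 : ℤ))) (l := (a, -(m + 1 : ℤ), (n + 1 : ℤ)))
      (m := (a, (m + 1 : ℤ), -(n + 1 : ℤ))) (n := (a, -(m + 1 : ℤ), -(n + 1 : ℤ)))
      ?_ ?_ ?_ ?_ ?_ ?_ ?_ j
    · intro h'; apply hp; simp only [det3] at h'; linarith
    · intro h'; apply hp; simp only [det3] at h'; linarith
    · intro h'; apply hp; simp only [det3] at h'; linarith
    · intro h'; apply hp; simp only [det3] at h'; linarith
    · simp only [nsq]; ring
    · simp only [nsq]; ring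
    · simp only [nsq]; ring

end Nodal

/-- On the flat `3`-torus `T³ = (ℝ/2πℤ)³` (with its Haar measure) there is an
orthonormal (Hilbert) basis of real `L²(T³)` consisting of continuous Laplacian
eigenfunctions (with eigenvalues `-λ_n ≤ 0`, the `2π`-periodic lifts being smooth and
satisfying `Δũ_n = -λ_n ũ_n`) such that every nonconstant eigenfunction of the basis
has exactly two nodal domains. -/
theorem stmt13 :
    ∃ (b : HilbertBasis ℕ ℝ (Lp ℝ 2 (volume : Measure T3)))
      (u : ℕ → T3 → ℝ) (lam : ℕ → ℝ),
      (∀ n, Continuous (u n)) ∧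
      (∀ n, 0 ≤ lam n) ∧
      (∀ n, ⇑(b n) =ᵐ[volume] u n) ∧
      (∀ n, ContDiff ℝ (⊤ : ℕ∞) (fun x : ℝ × ℝ × ℝ =>
        u n ((x.1 : AddCircle (2 * Real.pi)), (x.2.1 : AddCircle (2 * Real.pi)),
          (x.2.2 : AddCircle (2 * Real.pi))))) ∧
      (∀ n, ∀ x y z : ℝ,
        deriv (deriv (fun s : ℝ => u n ((s : AddCircle (2 * Real.pi)),
            (y : AddCircle (2 * Real.pi)), (z : AddCircle (2 * Real.pi))))) x +
        deriv (deriv (fun s : ℝ => u n ((x : AddCircle (2 * Real.pi)),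
            (s : AddCircle (2 * Real.pi)), (z : AddCircle (2 * Real.pi))))) y +
        deriv (deriv (fun s : ℝ => u n ((x : AddCircle (2 * Real.pi)),
            (y : AddCircle (2 * Real.pi)), (s : AddCircle (2 * Real.pi))))) z =
          -lam n * u n ((x : AddCircle (2 * Real.pi)), (y : AddCircle (2 * Real.pi)),
            (z : AddCircle (2 * Real.pi)))) ∧
      (∀ n, (¬ ∃ cst : ℝ, ∀ p : T3, u n p = cst) →
        Nat.card (ConnectedComponents {p : T3 // u n p ≠ 0}) = 2) := by
  let e : ℕ ≃ Nodal.Idx := (Denumerable.eqv (ℤ × ℤ × ℤ)).symm.trans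
    (Equiv.ofBijective Nodal.fr ⟨Nodal.fr_inj, Nodal.fr_surj⟩).symm
  have hon : Orthonormal ℝ (fun n => Nodal.toL (Nodal.bf (e n))) :=
    Nodal.bf_orthonormal.comp e e.injective
  have hr : Set.range (fun n => Nodal.toL (Nodal.bf (e n)))
      = Set.range (fun i => Nodal.toL (Nodal.bf i)) :=
    e.surjective.range_comp (fun i => Nodal.toL (Nodal.bf i))
  have hd : ⊤ ≤ (Submodule.span ℝ (Set.range fun n =>
      Nodal.toL (Nodal.bf (e n)))).topologicalClosure := by
    rw [hr]; exact Nodal.bf_dense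
  choose lam h0 h1 h2 h3 using Nodal.bf_nice
  refine ⟨HilbertBasis.mk hon hd, fun n => Nodal.bf (e n), fun n => lam (e n),
    fun n => (Nodal.bf (e n)).continuous, fun n => h0 (e n), fun n => ?_,
    fun n => h1 (e n), fun n => h2 (e n), fun n => h3 (e n)⟩
  rw [HilbertBasis.coe_mk]
  exact ContinuousMap.coeFn_toLp volume (Nodal.bf (e n))
end
end
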